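/- arXiv:2412.20609 — 2 statements merged into one kernel-verified Lean document; each statement's English description precedes it below -/
import Mathlib

section
/- Let R be either L or H and let S ⊆ R be finite and nonempty. Let m₁, …, m_t be the distinct minimal polynomials of the elements of S, and for each 1 ≤ i ≤ t set Sᵢ := S ∩ C_R(mᵢ). Then S is a ringset of R if and only if Sᵢ is a ringset of R for every 1 ≤ i ≤ t. -/
noncomputable section

open Polynomial

abbrev 𝔻 : Type := Quaternion ℚ

def qi : 𝔻 := QuaternionAlgebra.mk 0 1 0 0
def qj : 𝔻 := QuaternionAlgebra.mk 0 0 1 0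
def qk : 𝔻 := QuaternionAlgebra.mk 0 0 0 1

def isIntQ (q : ℚ) : Prop := ∃ z : ℤ, q = (z : ℚ)
def isHalfOddQ (q : ℚ) : Prop := ∃ z : ℤ, q = (z : ℚ) + 1/2

def Lip : Set 𝔻 :=
  {α | isIntQ α.re ∧ isIntQ α.imI ∧ isIntQ α.imJ ∧ isIntQ α.imK}

def HurOff : Set 𝔻 :=
  {α | isHalfOddQ α.re ∧ isHalfOddQ α.imI ∧ isHalfOddQ α.imJ ∧ isHalfOddQ α.imK}

def Hur : Set 𝔻 := Lip ∪ HurOff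

def qnorm (α : 𝔻) : ℚ := α.re ^ 2 + α.imI ^ 2 + α.imJ ^ 2 + α.imK ^ 2

def minPoly (α : 𝔻) : Polynomial ℚ :=
  if α.imI = 0 ∧ α.imJ = 0 ∧ α.imK = 0 then X - C α.re
  else X ^ 2 - C (2 * α.re) * X + C (qnorm α)

def classOf (R : Set 𝔻) (m : Polynomial ℤ) : Set 𝔻 :=
  {α | α ∈ R ∧ minPoly α = m.map (Int.castRingHom ℚ)}

def IntPolys (S R : Set 𝔻) : Set (Polynomial 𝔻) :=
  {f | ∀ α ∈ S, f.eval α ∈ R}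

def IsRingset (S R : Set 𝔻) : Prop :=
  ∀ f ∈ IntPolys S R, ∀ g ∈ IntPolys S R, f * g ∈ IntPolys S R

def transSet (S : Set 𝔻) (a : ℤ) : Set 𝔻 := (fun α => α + (a : 𝔻)) '' S

def scaleSet (n : ℤ) (R : Set 𝔻) : Set 𝔻 := (fun α => (n : 𝔻) * α) '' R

def IsReducedIn (S R : Set 𝔻) : Prop :=
  (∃ m : Polynomial ℤ, m.Monic ∧ m.natDegree = 2 ∧ S ⊆ classOf R m) ∧
  (∀ a n : ℤ, 2 ≤ n → ¬ (transSet S a ⊆ scaleSet n R))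

def diffs (S : Set 𝔻) : Set 𝔻 := {δ | ∃ α ∈ S, ∃ β ∈ S, δ = α - β}

def normsOf (S : Set 𝔻) : Set ℤ := {n : ℤ | ∃ δ ∈ diffs S, (n : ℚ) = qnorm δ}

def gam (S : Set 𝔻) : ℕ := sSup {g : ℕ | ∀ t ∈ normsOf S, (g : ℤ) ∣ t}

def starSet (S R : Set 𝔻) : Set 𝔻 :=
  {β | ∃ α ∈ S, ∃ u v : 𝔻, u ∈ R ∧ v ∈ R ∧ u * v = 1 ∧ v * u = 1 ∧ β = u * α * v}

def idealGen (R : Set 𝔻) (x : 𝔻) : Set 𝔻 :=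
  {β | ∃ n : ℕ, ∃ a b : Fin n → 𝔻, (∀ k, a k ∈ R) ∧ (∀ k, b k ∈ R) ∧ β = ∑ k, a k * x * b k}

theorem minPoly_monic (α : 𝔻) : (minPoly α).Monic := by
  unfold minPoly
  split_ifs
  · exact monic_X_sub_C _
  · monicity!

theorem minPoly_irreducible (α : 𝔻) : Irreducible (minPoly α) := by
  have hmonic := minPoly_monic α
  unfold minPoly at hmonic ⊢
  split_ifs at hmonic ⊢ with h
  · exact irreducible_X_sub_C _
  · have hdeg : (X ^ 2 - C (2 * α.re) * X + C (qnorm α) : ℚ[X]).natDegree = 2 := by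
      compute_degree!
    rw [hmonic.irreducible_iff_roots_eq_zero_of_degree_le_three hdeg.ge (by omega),
      Multiset.eq_zero_iff_forall_notMem]
    intro r hr
    have hroot := isRoot_of_mem_roots hr
    simp only [IsRoot.def, eval_add, eval_sub, eval_mul, eval_pow, eval_X, eval_C, qnorm] at hroot
    have hsum : (r - α.re) ^ 2 + α.imI ^ 2 + α.imJ ^ 2 + α.imK ^ 2 = 0 := by linarith
    apply h
    refine ⟨?_, ?_, ?_⟩ <;> refine pow_eq_zero_iff two_ne_zero |>.mp (le_antisymm ?_ (sq_nonneg _)) <;>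
      linarith [sq_nonneg (r - α.re), sq_nonneg α.imI, sq_nonneg α.imJ, sq_nonneg α.imK]

theorem aeval_minPoly (α : 𝔻) : aeval α (minPoly α) = 0 := by
  have hC (q : ℚ) : algebraMap ℚ 𝔻 q = (q : Quaternion ℚ) := rfl
  unfold minPoly
  split_ifs with h
  · obtain ⟨h1, h2, h3⟩ := h
    rw [map_sub, aeval_X, aeval_C, hC, sub_eq_zero]
    exact Quaternion.ext _ _ rfl h1 h2 h3
  · rw [map_add, map_sub, map_mul, map_pow, aeval_X, aeval_C, aeval_C, hC, hC, sq]
    apply Quaternion.ext <;> simp [qnorm, -Quaternion.coe_mul, Quaternion.re_zero, Quaternion.imI_zero,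
      Quaternion.imJ_zero, Quaternion.imK_zero] <;> ring

theorem minPoly_isCoprime {α β : 𝔻} (h : minPoly α ≠ minPoly β) :
    IsCoprime (minPoly α) (minPoly β) :=
  (minPoly_irreducible α).coprime_iff_not_dvd.mpr fun hdvd =>
    h <| eq_of_monic_of_associated (minPoly_monic α) (minPoly_monic β) <|
      (minPoly_irreducible α).associated_of_dvd (minPoly_irreducible β) hdvd

theorem commute_map_algebraMap (h : ℚ[X]) (f : 𝔻[X]) :
    Commute (h.map (algebraMap ℚ 𝔻)) f := by
  induction h using Polynomial.induction_on' with
  | add p q hp hq => simpa using hp.add_left hq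
  | monomial n a =>
    rw [map_monomial, ← C_mul_X_pow_eq_monomial]
    exact Commute.mul_left (Algebra.commutes a f) (X_pow_mul (p := f) (n := n))

theorem eval_mul_map_algebraMap (f : 𝔻[X]) (h : ℚ[X]) (α : 𝔻) :
    (f * h.map (algebraMap ℚ 𝔻)).eval α = f.eval α * aeval α h := by
  rw [eval, eval₂_mul_noncomm, ← eval, ← eval, eval_map_algebraMap]
  intro k
  rw [coeff_map]
  exact Algebra.commutes (h.coeff k) α

theorem zero_mem_of_eq_Lip_or_Hur {R : Set 𝔻} (hR : R = Lip ∨ R = Hur) : (0 : 𝔻) ∈ R := by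
  have h : (0 : 𝔻) ∈ Lip := by
    refine ⟨⟨0, ?_⟩, ⟨0, ?_⟩, ⟨0, ?_⟩, ⟨0, ?_⟩⟩ <;> exact Int.cast_zero.symm
  rcases hR with rfl | rfl
  exacts [h, Or.inl h]

theorem IsRingset.mono_of_separating {R S T : Set 𝔻} (hR : (0 : 𝔻) ∈ R) (hS : IsRingset S R)
    (hTS : T ⊆ S) (h : ℚ[X]) (h_one : ∀ α ∈ T, aeval α h = 1)
    (h_zero : ∀ α ∈ S, α ∉ T → aeval α h = 0) : IsRingset T R := by
  have hmem {f : 𝔻[X]} (hf : f ∈ IntPolys T R) :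
      f * h.map (algebraMap ℚ 𝔻) ∈ IntPolys S R := by
    intro α hα
    rw [eval_mul_map_algebraMap]
    by_cases hT : α ∈ T
    · simpa [h_one α hT] using hf α hT
    · simpa [h_zero α hα hT] using hR
  intro f hf g hg α hα
  have hfg := hS _ (hmem hf) _ (hmem hg) α (hTS hα)
  rwa [← mul_assoc, eval_mul_map_algebraMap, mul_assoc, (commute_map_algebraMap h g).eq,
    ← mul_assoc, eval_mul_map_algebraMap, h_one α hα, mul_one, mul_one] at hfg

/-- Minimal polynomial decomposition: S is a ringset iff each piece is. -/
theorem stmt_4 (R : Set 𝔻) (hR : R = Lip ∨ R = Hur)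
    (S : Set 𝔻) (hSsub : S ⊆ R) (hSfin : S.Finite) (hSne : S.Nonempty)
    (t : ℕ) (m : Fin t → Polynomial ℤ) (hinj : Function.Injective m)
    (hcover : ∀ α ∈ S, ∃ i, α ∈ classOf R (m i))
    (hhit : ∀ i, ∃ α ∈ S, α ∈ classOf R (m i)) :
    IsRingset S R ↔ ∀ i, IsRingset (S ∩ classOf R (m i)) R := by
  refine ⟨fun hS i => ?_, fun hS f hf g hg α hα => ?_⟩
  · set M : Fin t → ℚ[X] := fun j => (m j).map (Int.castRingHom ℚ) with hM
    have hMinj : Function.Injective M :=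
      (map_injective _ (RingHom.injective_int _)).comp hinj
    have hcop : IsCoprime (M i) (∏ j ∈ Finset.univ.erase i, M j) := by
      refine IsCoprime.prod_right fun j hj => ?_
      obtain ⟨α, -, -, hα⟩ := hhit i
      obtain ⟨β, -, -, hβ⟩ := hhit j
      have hne := hMinj.ne (Finset.ne_of_mem_erase hj).symm
      simp only [hM, ← hα, ← hβ] at hne ⊢
      exact minPoly_isCoprime hne
    obtain ⟨a, b, hab⟩ := hcop
    have haeval {α : 𝔻} {j : Fin t} (hα : α ∈ classOf R (m j)) : aeval α (M j) = 0 := by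
      rw [← aeval_minPoly α, hα.2]
    refine hS.mono_of_separating (zero_mem_of_eq_Lip_or_Hur hR) Set.inter_subset_left
      (b * ∏ j ∈ Finset.univ.erase i, M j) (fun α hα => ?_) fun α hα hαi => ?_
    · simpa [haeval hα.2] using congrArg (aeval α) hab
    · obtain ⟨j, hj⟩ := hcover α hα
      have hji : j ≠ i := by
        rintro rfl
        exact hαi ⟨hα, hj⟩
      obtain ⟨c, hc⟩ := (Finset.dvd_prod_of_mem M
        (Finset.mem_erase.mpr ⟨hji, Finset.mem_univ j⟩)).mul_left b
      rw [hc, map_mul, haeval hj, zero_mul]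
  · obtain ⟨i, hi⟩ := hcover α hα
    exact hS i f (fun β hβ => hf β hβ.1) g (fun β hβ => hg β hβ.1) α ⟨hα, hi⟩
end
end

section
/- (1) For every α ∈ L and every unit u ∈ L^×, α − uαu⁻¹ ∈ 2L. (2) Let I be the two-sided ideal of H generated by 1+i. For every α ∈ H and every unit u ∈ H^×, α − uαu⁻¹ ∈ I; moreover, if β ∈ H has even norm N(β), then β ∈ I. -/
noncomputable section

open Polynomial

theorem exists_quaternion_coords_eq (a b c d : ℚ) :
    ∃ z : 𝔻, z.re = a ∧ z.imI = b ∧ z.imJ = c ∧ z.imK = d :=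
  ⟨⟨a, b, c, d⟩, rfl, rfl, rfl, rfl⟩

theorem qi_coords : qi.re = 0 ∧ qi.imI = 1 ∧ qi.imJ = 0 ∧ qi.imK = 0 :=
  ⟨rfl, rfl, rfl, rfl⟩

theorem one_coords : (1 : 𝔻).re = 1 ∧ (1 : 𝔻).imI = 0 ∧ (1 : 𝔻).imJ = 0 ∧ (1 : 𝔻).imK = 0 :=
  ⟨rfl, rfl, rfl, rfl⟩

theorem mem_Hur_iff {x : 𝔻} : x ∈ Hur ↔ ∃ a b c d : ℤ,
    x.re = a / 2 ∧ x.imI = a / 2 + b ∧ x.imJ = a / 2 + c ∧ x.imK = a / 2 + d := by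
  constructor
  · rintro (⟨⟨a, ha⟩, ⟨b, hb⟩, ⟨c, hc⟩, ⟨d, hd⟩⟩ | ⟨⟨a, ha⟩, ⟨b, hb⟩, ⟨c, hc⟩, ⟨d, hd⟩⟩)
    · refine ⟨2 * a, b - a, c - a, d - a, ?_, ?_, ?_, ?_⟩ <;> push_cast <;> linarith
    · refine ⟨2 * a + 1, b - a, c - a, d - a, ?_, ?_, ?_, ?_⟩ <;> push_cast <;> linarith
  · rintro ⟨a, b, c, d, ha, hb, hc, hd⟩
    obtain ⟨e, rfl | rfl⟩ := Int.even_or_odd' a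
    · left
      refine ⟨⟨e, ?_⟩, ⟨e + b, ?_⟩, ⟨e + c, ?_⟩, ⟨e + d, ?_⟩⟩ <;> push_cast at * <;> linarith
    · right
      refine ⟨⟨e, ?_⟩, ⟨e + b, ?_⟩, ⟨e + c, ?_⟩, ⟨e + d, ?_⟩⟩ <;> push_cast at * <;> linarith

theorem Lip_mul_mem {x y : 𝔻} (hx : x ∈ Lip) (hy : y ∈ Lip) : x * y ∈ Lip := by
  obtain ⟨⟨a, ha⟩, ⟨b, hb⟩, ⟨c, hc⟩, ⟨d, hd⟩⟩ := hx
  obtain ⟨⟨p, hp⟩, ⟨q, hq⟩, ⟨r, hr⟩, ⟨s, hs⟩⟩ := hy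
  refine ⟨⟨a * p - b * q - c * r - d * s, ?_⟩, ⟨a * q + b * p + c * s - d * r, ?_⟩,
    ⟨a * r - b * s + c * p + d * q, ?_⟩, ⟨a * s + b * r - c * q + d * p, ?_⟩⟩ <;>
  simp [ha, hb, hc, hd, hp, hq, hr, hs]

theorem Hur_mul_mem {x y : 𝔻} (hx : x ∈ Hur) (hy : y ∈ Hur) : x * y ∈ Hur := by
  rw [mem_Hur_iff] at *
  obtain ⟨a, b, c, d, ha, hb, hc, hd⟩ := hx
  obtain ⟨p, q, r, s, hp, hq, hr, hs⟩ := hy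
  refine ⟨-a * p - a * (q + r + s) - p * (b + c + d) - 2 * (b * q + c * r + d * s),
    a * p + a * q + p * b + a * s + c * p + c * s - d * r + (b * q + c * r + d * s),
    a * p + a * r + p * c + a * q + d * p + d * q - b * s + (b * q + c * r + d * s),
    a * p + a * s + p * d + a * r + b * p + b * r - c * q + (b * q + c * r + d * s),
    ?_, ?_, ?_, ?_⟩ <;>
  simp [ha, hb, hc, hd, hp, hq, hr, hs] <;> ring

theorem one_mem_Hur : (1 : 𝔻) ∈ Hur :=
  mem_Hur_iff.2 ⟨2, -1, -1, -1, by simp [one_coords], by simp [one_coords], by simp [one_coords],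
    by simp [one_coords]⟩

theorem mul_mem_idealGen_Hur (x : 𝔻) {y : 𝔻} (hy : y ∈ Hur) : x * y ∈ idealGen Hur x :=
  ⟨1, fun _ => 1, fun _ => y, fun _ => one_mem_Hur, fun _ => hy, by simp⟩

theorem sub_conj_eq_commutator_mul {R : Type*} [Ring R] (x : R) {u v : R} (h : u * v = 1) :
    x - u * x * v = (x * u - u * x) * v := by
  rw [sub_mul, mul_assoc x u v, h, mul_one]

theorem exists_Lip_commutator_eq {x y : 𝔻} (hx : x ∈ Lip) (hy : y ∈ Lip) :
    ∃ z ∈ Lip, x * y - y * x = ((2 : ℤ) : 𝔻) * z := by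
  obtain ⟨⟨a, ha⟩, ⟨b, hb⟩, ⟨c, hc⟩, ⟨d, hd⟩⟩ := hx
  obtain ⟨⟨p, hp⟩, ⟨q, hq⟩, ⟨r, hr⟩, ⟨s, hs⟩⟩ := hy
  obtain ⟨z, h0, h1, h2, h3⟩ := exists_quaternion_coords_eq
    (0 : ℤ) (c * s - d * r : ℤ) (d * q - b * s : ℤ) (b * r - c * q : ℤ)
  refine ⟨z, ⟨⟨_, h0⟩, ⟨_, h1⟩, ⟨_, h2⟩, ⟨_, h3⟩⟩, ?_⟩
  rw [Int.cast_ofNat, two_mul]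
  ext <;> simp [h0, h1, h2, h3, ha, hb, hc, hd, hp, hq, hr, hs] <;> ring

theorem exists_Hur_commutator_eq {x y : 𝔻} (hx : x ∈ Hur) (hy : y ∈ Hur) :
    ∃ z ∈ Hur, x * y - y * x = (1 + qi) * z := by
  obtain ⟨a, b, c, d, ha, hb, hc, hd⟩ := mem_Hur_iff.1 hx
  obtain ⟨p, q, r, s, hp, hq, hr, hs⟩ := mem_Hur_iff.1 hy
  let X : ℤ := a * s + c * p - a * r - d * p + 2 * (c * s - d * r)
  let Z : ℤ := a * r + b * p - a * q - c * p + 2 * (b * r - c * q)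
  let S : ℤ := c * s - d * r + (d * q - b * s) + (b * r - c * q)
  obtain ⟨z, h0, h1, h2, h3⟩ := exists_quaternion_coords_eq
    (X / 2) (X / 2 + (0 : ℤ)) (X / 2 + (S - X : ℤ)) (X / 2 + (Z - S : ℤ))
  refine ⟨z, mem_Hur_iff.2 ⟨_, _, _, _, h0, h1, h2, h3⟩, ?_⟩
  ext <;> simp [ha, hb, hc, hd, hp, hq, hr, hs, h0, h1, h2, h3, qi_coords, one_coords, X, Z, S] <;> ring

theorem exists_Hur_eq_of_even_qnorm {x : 𝔻} (hx : x ∈ Hur) {n : ℤ}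
    (hn : qnorm x = ((2 * n : ℤ) : ℚ)) : ∃ z ∈ Hur, x = (1 + qi) * z := by
  obtain ⟨a, b, c, d, ha, hb, hc, hd⟩ := mem_Hur_iff.1 hx
  have h : a * a + a * (b + c + d) + (b * b + c * c + d * d) = 2 * n := by
    have : (a * a + a * (b + c + d) + (b * b + c * c + d * d) : ℚ) = (2 * n : ℤ) := by
      rw [← hn, qnorm, ha, hb, hc, hd]
      ring
    exact_mod_cast this
  have hev : Even (a * a + a * (b + c + d) + (b * b + c * c + d * d)) := h ▸ even_two_mul n
  have ha2 : Even a := by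
    by_contra hodd
    simp only [Int.even_add, Int.even_mul] at hev
    tauto
  have hs2 : Even (b + c + d) := by
    simp only [Int.even_add, Int.even_mul] at hev ⊢
    tauto
  obtain ⟨e, rfl⟩ := ha2
  obtain ⟨f, hf⟩ := hs2
  obtain rfl : d = f + f - b - c := by linarith
  obtain ⟨z, h0, h1, h2, h3⟩ := exists_quaternion_coords_eq
    ((2 * e + b : ℤ) / 2) ((2 * e + b : ℤ) / 2 + (-e : ℤ))
    ((2 * e + b : ℤ) / 2 + (f - b : ℤ)) ((2 * e + b : ℤ) / 2 + (f - b - c - e : ℤ))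
  refine ⟨z, mem_Hur_iff.2 ⟨_, _, _, _, h0, h1, h2, h3⟩, ?_⟩
  ext <;> simp [ha, hb, hc, hd, h0, h1, h2, h3, qi_coords, one_coords] <;> ring

/-- Differences of conjugates: in 2L for L, and in the ideal (1+i) for H;
moreover elements of H of even norm lie in that ideal. -/
theorem stmt_10 :
    (∀ α ∈ Lip, ∀ u v : 𝔻, u ∈ Lip → v ∈ Lip → u * v = 1 → v * u = 1 →
      α - u * α * v ∈ scaleSet 2 Lip) ∧
    (∀ α ∈ Hur, ∀ u v : 𝔻, u ∈ Hur → v ∈ Hur → u * v = 1 → v * u = 1 →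
      α - u * α * v ∈ idealGen Hur (1 + qi)) ∧
    (∀ β ∈ Hur, (∃ z : ℤ, qnorm β = ((2 * z : ℤ) : ℚ)) →
      β ∈ idealGen Hur (1 + qi)) := by
  refine ⟨?_, ?_, ?_⟩
  · intro α hα u v hu hv huv _
    obtain ⟨z, hz, h⟩ := exists_Lip_commutator_eq hα hu
    exact ⟨z * v, Lip_mul_mem hz hv, by
      rw [sub_conj_eq_commutator_mul α huv, h, mul_assoc]⟩
  · intro α hα u v hu hv huv _
    obtain ⟨z, hz, h⟩ := exists_Hur_commutator_eq hα hu
    rw [sub_conj_eq_commutator_mul α huv, h, mul_assoc]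
    exact mul_mem_idealGen_Hur _ (Hur_mul_mem hz hv)
  · rintro β hβ ⟨n, hn⟩
    obtain ⟨z, hz, rfl⟩ := exists_Hur_eq_of_even_qnorm hβ hn
    exact mul_mem_idealGen_Hur _ hz
end
end
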